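/- Assume the GBDT setup on [a,b] with ξ = a: J = J* = J^{−1} ∈ ℂ^{m×m}; H(x) = β(x)*β(x) with β : [a,b] → ℂ^{k×m} continuous; B ∈ ℂ^{n×n} with B − x I_n invertible on [a,b]; A(x) = (B − x I_n)^{−1}; Π, S differentiable with Π_x = −i A Π J H, S_x = Π J H J* Π* − (A S + S A*), S(a) = S(a)*, A(a)S(a) − S(a)A(a)* = i Π(a) J Π(a)*, and S(x) invertible on [a,b]. Set w_0(x) = I_m − i J Π(x)* S(x)^{−1} A(x)^{−1} Π(x), β̃ = β w_0, and v(x,z) = w_0(x)^{−1}(I_m − i J Π(x)* S(x)^{−1} (A(x) − (z−x)^{−1} I_n)^{−1} Π(x)). Let 𝔄 and 𝔄̃ be the operators on L²_k(a,b) given by (𝔄 f)(x) = x f(x) + i ∫_a^x β(x) J β(t)* f(t) dt and (𝔄̃ f)(x) = x f(x) + i ∫_a^x β̃(x) J β̃(t)* f(t) dt, with characteristic matrix functions 𝒲(z) = I_m − i J 𝒦*(𝔄 − zI)^{−1}𝒦 and 𝒲̃(z) = I_m − i J 𝒦̃*(𝔄̃ − zI)^{−1}𝒦̃, where (𝒦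 g)(x) = β(x) g and (𝒦̃ g)(x) = β̃(x) g. Then for every z ∉ [a,b] with B − z I_n and B − z̄ I_n invertible, 𝒲̃(z) = v(b,z) 𝒲(z) v(a,z)^{−1}. -/

import Mathlib

open Matrix MeasureTheory

attribute [local instance] Matrix.normedAddCommGroup Matrix.normedSpace

/-- `A(x) = (B − x Iₙ)⁻¹`. -/
noncomputable def Amat {n : ℕ} (B : Matrix (Fin n) (Fin n) ℂ) (x : ℝ) :
    Matrix (Fin n) (Fin n) ℂ :=
  (B - (x : ℂ) • (1 : Matrix (Fin n) (Fin n) ℂ))⁻¹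

/-- `w₀(x) = I_m − i J Π(x)* S(x)⁻¹ A(x)⁻¹ Π(x)`. -/
noncomputable def w0fun {m n : ℕ} (J : Matrix (Fin m) (Fin m) ℂ)
    (B : Matrix (Fin n) (Fin n) ℂ) (S : ℝ → Matrix (Fin n) (Fin n) ℂ)
    (Φ : ℝ → Matrix (Fin n) (Fin m) ℂ) (x : ℝ) : Matrix (Fin m) (Fin m) ℂ :=
  1 - Complex.I • (J * (Φ x)ᴴ * (S x)⁻¹ * (Amat B x)⁻¹ * Φ x)

/-- `v(x,z) = w₀(x)⁻¹ (I_m − i J Π(x)* S(x)⁻¹ (A(x) − (z−x)⁻¹ Iₙ)⁻¹ Π(x))`. -/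
noncomputable def vfun {m n : ℕ} (J : Matrix (Fin m) (Fin m) ℂ)
    (B : Matrix (Fin n) (Fin n) ℂ) (S : ℝ → Matrix (Fin n) (Fin n) ℂ)
    (Φ : ℝ → Matrix (Fin n) (Fin m) ℂ) (z : ℂ) (x : ℝ) :
    Matrix (Fin m) (Fin m) ℂ :=
  (w0fun J B S Φ x)⁻¹ *
    (1 - Complex.I • (J * (Φ x)ᴴ * (S x)⁻¹ *
      (Amat B x - (z - (x : ℂ))⁻¹ • (1 : Matrix (Fin n) (Fin n) ℂ))⁻¹ * Φ x))

/-- The Livšic–Brodskii characteristic matrix function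
`𝒲(z) = I_m − i J 𝒦* (𝔄 − z I)⁻¹ 𝒦`, written entrywise; here `R` is the
resolvent `(𝔄 − z I)⁻¹` and `𝒦*` is the Hilbert-space adjoint of `𝒦`. -/
noncomputable def charFun {m k : ℕ} (a b : ℝ) (J : Matrix (Fin m) (Fin m) ℂ)
    (𝒦 : EuclideanSpace ℂ (Fin m) →L[ℂ]
      Lp (EuclideanSpace ℂ (Fin k)) 2 (volume.restrict (Set.Ioo a b)))
    (R : Lp (EuclideanSpace ℂ (Fin k)) 2 (volume.restrict (Set.Ioo a b)) →L[ℂ]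
      Lp (EuclideanSpace ℂ (Fin k)) 2 (volume.restrict (Set.Ioo a b))) :
    Matrix (Fin m) (Fin m) ℂ :=
  1 - Complex.I • (J * Matrix.of fun p q : Fin m =>
    (ContinuousLinearMap.adjoint 𝒦 (R (𝒦 (EuclideanSpace.single q 1)))) p)

section MatrixCalculus

variable {ι κ μ : Type*} [Fintype κ]

theorem hasDerivAt_matrix_iff {F : ℝ → Matrix ι κ ℂ} {F' : Matrix ι κ ℂ} {x : ℝ} :
    HasDerivAt F F' x ↔ ∀ i j, HasDerivAt (fun t => F t i j) (F' i j) x :=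
  hasDerivAt_pi.trans (forall_congr' fun _ => hasDerivAt_pi)

variable [Fintype μ]

theorem HasDerivAt.matrix_mul {F : ℝ → Matrix ι κ ℂ} {G : ℝ → Matrix κ μ ℂ}
    {F' : Matrix ι κ ℂ} {G' : Matrix κ μ ℂ} {x : ℝ}
    (hF : HasDerivAt F F' x) (hG : HasDerivAt G G' x) :
    HasDerivAt (fun t => F t * G t) (F' * G x + F x * G') x := by
  rw [hasDerivAt_matrix_iff] at *
  intro i j
  simp only [Matrix.mul_apply, Matrix.add_apply, ← Finset.sum_add_distrib]
  exact HasDerivAt.fun_sum fun l _ => (hF i l).mul (hG l j)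

theorem HasDerivAt.matrix_mulVec {F : ℝ → Matrix ι κ ℂ} {u : ℝ → κ → ℂ}
    {F' : Matrix ι κ ℂ} {u' : κ → ℂ} {x : ℝ}
    (hF : HasDerivAt F F' x) (hu : HasDerivAt u u' x) :
    HasDerivAt (fun t => F t *ᵥ u t) (F' *ᵥ u x + F x *ᵥ u') x := by
  rw [hasDerivAt_matrix_iff] at hF
  rw [hasDerivAt_pi] at *
  intro i
  simp only [Matrix.mulVec, dotProduct, Pi.add_apply, ← Finset.sum_add_distrib]
  exact HasDerivAt.fun_sum fun l _ => (hF i l).mul (hu l)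

variable [Fintype ι]

theorem HasDerivAt.matrix_conjTranspose {F : ℝ → Matrix ι κ ℂ} {F' : Matrix ι κ ℂ} {x : ℝ}
    (hF : HasDerivAt F F' x) : HasDerivAt (fun t => (F t)ᴴ) F'ᴴ x := by
  rw [hasDerivAt_matrix_iff] at *
  exact fun i j => (hF j i).star

theorem HasDerivAt.matrix_inv [DecidableEq ι] {F : ℝ → Matrix ι ι ℂ} {F' : Matrix ι ι ℂ} {x : ℝ}
    (hF : HasDerivAt F F' x) (hx : IsUnit (F x)) :
    HasDerivAt (fun t => (F t)⁻¹) (-((F x)⁻¹ * F' * (F x)⁻¹)) x := by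
  have hc : ContinuousAt F x := hF.continuousAt
  have hdet : (F x).det ≠ 0 := ((Matrix.isUnit_iff_isUnit_det _).1 hx).ne_zero
  have hcdet : ContinuousAt (fun t => (F t).det) x :=
    (continuous_id.matrix_det).continuousAt.comp hc
  have hinv : ContinuousAt (fun t => (F t)⁻¹) x := by
    simp only [Matrix.inv_def, Ring.inverse_eq_inv']
    exact (hcdet.inv₀ hdet).smul ((continuous_id.matrix_adjugate).continuousAt.comp hc)
  rw [hasDerivAt_matrix_iff] at hF ⊢
  have hslope : Filter.Tendsto (fun t => Matrix.of fun i j => slope (fun s => F s i j) x t)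
      (nhdsWithin x {x}ᶜ) (nhds F') :=
    tendsto_pi_nhds.2 fun i => tendsto_pi_nhds.2 fun j => (hF i j).tendsto_slope
  have hlim : Filter.Tendsto
      (fun t => -((F t)⁻¹ * (Matrix.of fun i j => slope (fun s => F s i j) x t) * (F x)⁻¹))
      (nhdsWithin x {x}ᶜ) (nhds (-((F x)⁻¹ * F' * (F x)⁻¹))) := by
    have h0 : Filter.Tendsto (fun t => (F t)⁻¹) (nhdsWithin x {x}ᶜ) (nhds (F x)⁻¹) :=
      Filter.Tendsto.mono_left hinv nhdsWithin_le_nhds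
    exact ((h0.mul hslope).mul_const _).neg
  intro i j
  rw [hasDerivAt_iff_tendsto_slope]
  refine (tendsto_pi_nhds.1 (tendsto_pi_nhds.1 hlim i) j).congr' ?_
  filter_upwards [nhdsWithin_le_nhds (hcdet.eventually_ne hdet)] with t ht
  have h1 : (F t)⁻¹ * F t = 1 := Matrix.nonsing_inv_mul _ ht.isUnit
  have h2 : F x * (F x)⁻¹ = 1 := Matrix.mul_nonsing_inv _ hdet.isUnit
  have h3 : (Matrix.of fun i j => slope (fun s => F s i j) x t) = (t - x)⁻¹ • (F t - F x) := by
    ext i j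
    simp [slope_def_module]
  have h4 : -((F t)⁻¹ * (F t - F x) * (F x)⁻¹) = (F t)⁻¹ - (F x)⁻¹ := by
    rw [Matrix.mul_sub, h1, Matrix.sub_mul, Matrix.mul_assoc, h2, Matrix.one_mul, Matrix.mul_one,
      neg_sub]
  rw [h3, Matrix.mul_smul, Matrix.smul_mul, ← smul_neg, h4]
  simp [slope_def_module]

end MatrixCalculus
section Darboux
variable {m n : ℕ}

/-- The transfer matrix `I − i J Φ* S⁻¹ X Φ`. -/
noncomputable def transferMat (J : Matrix (Fin m) (Fin m) ℂ) (S : Matrix (Fin n) (Fin n) ℂ)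
    (Φ : Matrix (Fin n) (Fin m) ℂ) (X : Matrix (Fin n) (Fin n) ℂ) : Matrix (Fin m) (Fin m) ℂ :=
  1 - Complex.I • (J * Φᴴ * S⁻¹ * X * Φ)

theorem transferMat_mul_mul_conjTranspose {J : Matrix (Fin m) (Fin m) ℂ}
    {A S : Matrix (Fin n) (Fin n) ℂ} {Φ : Matrix (Fin n) (Fin m) ℂ} {l : ℂ}
    (hJ : Jᴴ = J) (hS : Sᴴ = S) (hSu : IsUnit S)
    (hid : A * S - S * Aᴴ = Complex.I • (Φ * J * Φᴴ))
    (hA : IsUnit (A - l • (1 : Matrix (Fin n) (Fin n) ℂ)))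
    (hA' : IsUnit (A - (starRingEnd ℂ l) • (1 : Matrix (Fin n) (Fin n) ℂ))) :
    transferMat J S Φ (A - l • (1 : Matrix (Fin n) (Fin n) ℂ))⁻¹ * J *
      (transferMat J S Φ (A - (starRingEnd ℂ l) • (1 : Matrix (Fin n) (Fin n) ℂ))⁻¹)ᴴ = J := by
  set X := (A - l • (1 : Matrix (Fin n) (Fin n) ℂ))⁻¹ with hX
  set Y := ((A - (starRingEnd ℂ l) • (1 : Matrix (Fin n) (Fin n) ℂ))⁻¹)ᴴ with hY
  have h1 : X * (A - l • (1 : Matrix (Fin n) (Fin n) ℂ)) = 1 :=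
    Matrix.nonsing_inv_mul _ ((Matrix.isUnit_iff_isUnit_det _).1 hA)
  have h2 : (Aᴴ - l • (1 : Matrix (Fin n) (Fin n) ℂ)) * Y = 1 := by
    have := congrArg Matrix.conjTranspose
      (Matrix.nonsing_inv_mul _ ((Matrix.isUnit_iff_isUnit_det _).1 hA'))
    simpa [Matrix.conjTranspose_mul, hY] using this
  have h3 : S⁻¹ * S = 1 := Matrix.nonsing_inv_mul _ ((Matrix.isUnit_iff_isUnit_det _).1 hSu)
  have h4 : S * S⁻¹ = 1 := Matrix.mul_nonsing_inv _ ((Matrix.isUnit_iff_isUnit_det _).1 hSu)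
  have hid' : Φ * J * Φᴴ = -Complex.I • ((A - l • (1 : Matrix (Fin n) (Fin n) ℂ)) * S -
      S * (Aᴴ - l • (1 : Matrix (Fin n) (Fin n) ℂ))) := by
    have : (A - l • (1 : Matrix (Fin n) (Fin n) ℂ)) * S -
      S * (Aᴴ - l • (1 : Matrix (Fin n) (Fin n) ℂ)) = A * S - S * Aᴴ := by
      simp [Matrix.sub_mul, Matrix.mul_sub]
    rw [this, hid, smul_smul]; simp
  have key : (S⁻¹ * X) * (Φ * J * Φᴴ) * (Y * S⁻¹) = -Complex.I • (Y * S⁻¹ - S⁻¹ * X) := by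
    rw [hid']
    generalize A - l • (1 : Matrix (Fin n) (Fin n) ℂ) = M at h1
    generalize Aᴴ - l • (1 : Matrix (Fin n) (Fin n) ℂ) = N at h2
    calc (S⁻¹ * X) * (-Complex.I • (M * S - S * N)) * (Y * S⁻¹)
        = -Complex.I • (S⁻¹ * (X * M) * S * Y * S⁻¹ - S⁻¹ * X * S * (N * Y) * S⁻¹) := by
          simp only [Matrix.mul_smul, Matrix.smul_mul, Matrix.mul_sub, Matrix.sub_mul,
            Matrix.mul_assoc]
      _ = -Complex.I • ((S⁻¹ * S) * Y * S⁻¹ - S⁻¹ * X * (S * S⁻¹)) := by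
          rw [h1, h2]; simp only [Matrix.mul_one, Matrix.mul_assoc]
      _ = _ := by rw [h3, h4, Matrix.one_mul, Matrix.mul_one]
  have key2 : (Φᴴ * S⁻¹ * X * Φ) * J * (Φᴴ * Y * S⁻¹ * Φ) =
      -Complex.I • (Φᴴ * Y * S⁻¹ * Φ - Φᴴ * S⁻¹ * X * Φ) := by
    have := congrArg (fun M => Φᴴ * M * Φ) key
    simpa only [Matrix.mul_assoc, Matrix.mul_smul, Matrix.smul_mul, Matrix.mul_sub,
      Matrix.sub_mul] using this
  have hstar : (transferMat J S Φ (A - (starRingEnd ℂ l) • (1 : Matrix (Fin n) (Fin n) ℂ))⁻¹)ᴴ =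
      1 + Complex.I • ((Φᴴ * Y * S⁻¹ * Φ) * J) := by
    simp [transferMat, Matrix.conjTranspose_mul, hJ, Matrix.conjTranspose_nonsing_inv, hS, hY,
      Matrix.mul_assoc]
  have hX' : transferMat J S Φ X = 1 - Complex.I • (J * (Φᴴ * S⁻¹ * X * Φ)) := by
    simp only [transferMat, Matrix.mul_assoc]
  rw [hstar, hX']
  generalize Φᴴ * S⁻¹ * X * Φ = P at *
  generalize Φᴴ * Y * S⁻¹ * Φ = Q at *
  calc (1 - Complex.I • (J * P)) * J * (1 + Complex.I • (Q * J))
      = J - Complex.I • (J * P * J) + Complex.I • (J * Q * J)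
        - (Complex.I * Complex.I) • (J * (P * J * Q) * J) := by
        simp only [Matrix.mul_smul, Matrix.smul_mul, Matrix.mul_add, Matrix.sub_mul,
            Matrix.mul_assoc, Matrix.mul_one, Matrix.one_mul, smul_sub, smul_smul]
        abel
    _ = J := by
        rw [key2]
        simp only [Matrix.mul_smul, Matrix.smul_mul, Matrix.mul_sub, Matrix.sub_mul, smul_sub,
          smul_smul, Complex.I_mul_I, mul_neg, neg_mul, one_mul, neg_neg, Matrix.mul_assoc]
        abel

theorem hasDerivAt_Amat {B : Matrix (Fin n) (Fin n) ℂ} {x : ℝ}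
    (hB : IsUnit (B - (x : ℂ) • (1 : Matrix (Fin n) (Fin n) ℂ))) :
    HasDerivAt (Amat B) (Amat B x * Amat B x) x := by
  have h : HasDerivAt (fun t : ℝ => B - (t : ℂ) • (1 : Matrix (Fin n) (Fin n) ℂ)) (-1) x := by
    rw [hasDerivAt_matrix_iff]
    intro i j
    have h1 : HasDerivAt (fun t : ℝ => (t : ℂ)) 1 x := Complex.ofRealCLM.hasDerivAt
    simpa using (h1.mul_const ((1 : Matrix (Fin n) (Fin n) ℂ) i j)).const_sub (B i j)
  have := h.matrix_inv hB
  simp only [Matrix.mul_neg, Matrix.neg_mul, Matrix.mul_one, neg_neg] at this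
  exact this

theorem hasDerivAt_transferMat {J H : Matrix (Fin m) (Fin m) ℂ} {B : Matrix (Fin n) (Fin n) ℂ}
    {Φ : ℝ → Matrix (Fin n) (Fin m) ℂ} {S : ℝ → Matrix (Fin n) (Fin n) ℂ} {l : ℝ → ℂ} {x : ℝ}
    (hJ : Jᴴ = J) (hH : Hᴴ = H)
    (hB : IsUnit (B - (x : ℂ) • (1 : Matrix (Fin n) (Fin n) ℂ)))
    (hΦ : HasDerivAt Φ (-(Complex.I • (Amat B x * Φ x * J * H))) x)
    (hS : HasDerivAt S
      (Φ x * J * H * Jᴴ * (Φ x)ᴴ - (Amat B x * S x + S x * (Amat B x)ᴴ)) x)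
    (hid : Amat B x * S x - S x * (Amat B x)ᴴ = Complex.I • (Φ x * J * (Φ x)ᴴ))
    (hSu : IsUnit (S x)) (hl : HasDerivAt l (l x * l x) x)
    (hA : IsUnit (Amat B x - l x • (1 : Matrix (Fin n) (Fin n) ℂ))) :
    HasDerivAt (fun t => transferMat J (S t) (Φ t)
        (Amat B t - l t • (1 : Matrix (Fin n) (Fin n) ℂ))⁻¹)
      ((J * H * J * ((Φ x)ᴴ * (S x)⁻¹ * Φ x) - Complex.I • (J * ((Φ x)ᴴ * (S x)⁻¹ * Φ x)) -
          J * ((Φ x)ᴴ * (S x)⁻¹ * Φ x) * J * H) *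
        transferMat J (S x) (Φ x) (Amat B x - l x • (1 : Matrix (Fin n) (Fin n) ℂ))⁻¹ +
      (Complex.I * l x) •
        (J * H * transferMat J (S x) (Φ x) (Amat B x - l x • (1 : Matrix (Fin n) (Fin n) ℂ))⁻¹ -
          transferMat J (S x) (Φ x) (Amat B x - l x • (1 : Matrix (Fin n) (Fin n) ℂ))⁻¹ *
            J * H)) x := by
  have hAd := hasDerivAt_Amat hB
  have hAl : HasDerivAt (fun t => Amat B t - l t • (1 : Matrix (Fin n) (Fin n) ℂ))
      (Amat B x * Amat B x - (l x * l x) • (1 : Matrix (Fin n) (Fin n) ℂ)) x := by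
    rw [hasDerivAt_matrix_iff] at *
    intro i j
    exact (hAd i j).sub (hl.mul_const ((1 : Matrix (Fin n) (Fin n) ℂ) i j))
  have hXd := hAl.matrix_inv hA
  have hC := hXd.matrix_mul hΦ
  have hD := hΦ.matrix_conjTranspose.matrix_mul (hS.matrix_inv hSu)
  have hP := ((hasDerivAt_const x J).matrix_mul (hD.matrix_mul hC))
  have hV : HasDerivAt (fun t => transferMat J (S t) (Φ t)
      (Amat B t - l t • (1 : Matrix (Fin n) (Fin n) ℂ))⁻¹) _ x :=
    ((hP.const_smul Complex.I).const_sub 1).congr_of_eventuallyEq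
      (Filter.Eventually.of_forall fun t => by
        simp only [transferMat, Matrix.mul_assoc, Pi.smul_apply])
  refine hV.congr_deriv ?_
  have hAX : Amat B x * (Amat B x - l x • (1 : Matrix (Fin n) (Fin n) ℂ))⁻¹ =
      1 + l x • (Amat B x - l x • (1 : Matrix (Fin n) (Fin n) ℂ))⁻¹ := by
    have := Matrix.mul_nonsing_inv _ ((Matrix.isUnit_iff_isUnit_det _).1 hA)
    rw [Matrix.sub_mul, Matrix.smul_mul, Matrix.one_mul] at this
    exact sub_eq_iff_eq_add.1 this
  have hXA : (Amat B x - l x • (1 : Matrix (Fin n) (Fin n) ℂ))⁻¹ * Amat B x =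
      1 + l x • (Amat B x - l x • (1 : Matrix (Fin n) (Fin n) ℂ))⁻¹ := by
    have := Matrix.nonsing_inv_mul _ ((Matrix.isUnit_iff_isUnit_det _).1 hA)
    rw [Matrix.mul_sub, Matrix.mul_smul, Matrix.mul_one] at this
    exact sub_eq_iff_eq_add.1 this
  have hSi := Matrix.nonsing_inv_mul _ ((Matrix.isUnit_iff_isUnit_det _).1 hSu)
  have hSi' := Matrix.mul_nonsing_inv _ ((Matrix.isUnit_iff_isUnit_det _).1 hSu)
  simp only [transferMat, Matrix.zero_mul, zero_add]
  generalize (Amat B x - l x • (1 : Matrix (Fin n) (Fin n) ℂ))⁻¹ = X at *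
  generalize Amat B x = A at *
  generalize l x = z at *
  generalize Φ x = F at *
  generalize (S x)⁻¹ = R at *
  generalize S x = T at *
  have hRA : Aᴴ * R = R * A - Complex.I • (R * F * J * Fᴴ * R) := by
    have := congrArg (fun M => R * M * R) hid
    simp only [Matrix.mul_sub, Matrix.sub_mul, Matrix.mul_smul, Matrix.smul_mul] at this
    rw [show R * (A * T) * R = R * A by rw [Matrix.mul_assoc, Matrix.mul_assoc, hSi',
      Matrix.mul_one], show R * (T * Aᴴ) * R = Aᴴ * R by
      rw [← Matrix.mul_assoc, hSi, Matrix.one_mul]] at this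
    rw [show R * F * J * Fᴴ * R = R * (F * J * Fᴴ) * R by simp only [Matrix.mul_assoc], ← this]
    abel
  have hX2 : X * (A * A - (z * z) • (1 : Matrix (Fin n) (Fin n) ℂ)) * X = 1 + (2 * z) • X := by
    calc _ = (X * A) * (A * X) - (z * z) • (X * X) := by
          simp [Matrix.mul_sub, Matrix.sub_mul, Matrix.mul_assoc]
      _ = _ := by
          rw [hAX, hXA]
          simp only [Matrix.mul_add, Matrix.add_mul, Matrix.mul_one, Matrix.one_mul,
            Matrix.mul_smul, Matrix.smul_mul]
          module
  have hCe : -(X * (A * A - (z * z) • (1 : Matrix (Fin n) (Fin n) ℂ)) * X) * F +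
      X * -(Complex.I • (A * F * J * H)) =
      -F - (2 * z) • (X * F) - Complex.I • ((F + z • (X * F)) * J * H) := by
    rw [hX2, show X * -(Complex.I • (A * F * J * H)) = -(Complex.I • ((X * A) * F * J * H)) by
      simp only [Matrix.mul_neg, Matrix.mul_smul, Matrix.mul_assoc], hXA]
    simp only [Matrix.neg_mul, Matrix.add_mul, Matrix.one_mul, Matrix.smul_mul]
    module
  have hDe : (-(Complex.I • (A * F * J * H)))ᴴ * R +
      Fᴴ * -(R * (F * J * H * Jᴴ * Fᴴ - (A * T + T * Aᴴ)) * R) =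
      Complex.I • (H * J * (Fᴴ * R * A)) + H * J * (Fᴴ * R * F) * J * (Fᴴ * R)
        - (Fᴴ * R * F) * J * H * J * (Fᴴ * R) + (2 : ℂ) • (Fᴴ * R * A)
        - Complex.I • ((Fᴴ * R * F) * J * (Fᴴ * R)) := by
    have e1 : (-(Complex.I • (A * F * J * H)))ᴴ * R = Complex.I • (H * J * Fᴴ * (Aᴴ * R)) := by
      simp [Matrix.conjTranspose_mul, hJ, hH, Matrix.mul_assoc]
    have e2 : R * (F * J * H * Jᴴ * Fᴴ - (A * T + T * Aᴴ)) * R =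
        R * F * J * H * J * Fᴴ * R - R * A * (T * R) - (R * T) * (Aᴴ * R) := by
      simp only [hJ, Matrix.mul_sub, Matrix.sub_mul, Matrix.mul_add, Matrix.add_mul,
        Matrix.mul_assoc]
      abel
    rw [e1, e2, hSi, hSi', hRA]
    simp only [Matrix.mul_sub, Matrix.mul_one, Matrix.one_mul, Matrix.mul_smul,
      Matrix.mul_neg, smul_sub, smul_smul, Complex.I_mul_I, Matrix.mul_assoc]
    module
  rw [hCe, hDe]
  have hAC : Fᴴ * R * A * (X * F) = Fᴴ * R * F + z • (Fᴴ * R * (X * F)) := by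
    rw [show Fᴴ * R * A * (X * F) = Fᴴ * R * (A * X) * F by simp only [Matrix.mul_assoc], hAX]
    simp only [Matrix.mul_add, Matrix.add_mul, Matrix.mul_one, Matrix.mul_smul, Matrix.smul_mul,
      Matrix.mul_assoc]
  rw [show J * Fᴴ * R * X * F = J * (Fᴴ * R * (X * F)) by simp only [Matrix.mul_assoc]]
  have hPe : (Complex.I • (H * J * (Fᴴ * R * A)) + H * J * (Fᴴ * R * F) * J * (Fᴴ * R)
        - (Fᴴ * R * F) * J * H * J * (Fᴴ * R) + (2 : ℂ) • (Fᴴ * R * A)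
        - Complex.I • ((Fᴴ * R * F) * J * (Fᴴ * R))) * (X * F) +
      Fᴴ * R * (-F - (2 * z) • (X * F) - Complex.I • ((F + z • (X * F)) * J * H)) =
      Complex.I • (H * J * (Fᴴ * R * A * (X * F)))
        + H * J * (Fᴴ * R * F) * J * (Fᴴ * R * (X * F))
        - (Fᴴ * R * F) * J * H * J * (Fᴴ * R * (X * F)) + (2 : ℂ) • (Fᴴ * R * A * (X * F))
        - Complex.I • ((Fᴴ * R * F) * J * (Fᴴ * R * (X * F)))
        - Fᴴ * R * F - (2 * z) • (Fᴴ * R * (X * F))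
        - Complex.I • ((Fᴴ * R * F + z • (Fᴴ * R * (X * F))) * J * H) := by
    simp only [Matrix.mul_add, Matrix.add_mul, Matrix.mul_sub, Matrix.sub_mul, Matrix.mul_smul,
      Matrix.smul_mul, Matrix.mul_neg, Matrix.mul_assoc]
    module
  rw [hPe, hAC]
  generalize Fᴴ * R * (X * F) = P at *
  generalize Fᴴ * R * F = Q at *
  simp only [Matrix.mul_add, Matrix.add_mul, Matrix.mul_sub, Matrix.sub_mul, Matrix.mul_smul,
    Matrix.smul_mul, Matrix.mul_one, Matrix.one_mul, smul_sub, smul_add, smul_smul,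
    ← Matrix.mul_assoc]
  match_scalars <;> ring_nf <;> simp only [Complex.I_sq] <;> ring_nf

theorem eq_of_hasDerivAt_matrix_zero {ι κ : Type*} [Fintype ι] [Fintype κ]
    {F : ℝ → Matrix ι κ ℂ} {a b : ℝ} (hF : ∀ x ∈ Set.Icc a b, HasDerivAt F 0 x) :
    ∀ x ∈ Set.Icc a b, F x = F a := by
  intro x hx
  ext i j
  have h : ∀ y ∈ Set.Icc a b, HasDerivAt (fun t => F t i j) 0 y := fun y hy =>
    hasDerivAt_matrix_iff.1 (hF y hy) i j
  exact constant_of_has_deriv_right_zero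
    (fun y hy => (h y hy).continuousAt.continuousWithinAt)
    (fun y hy => (h y (Set.Ico_subset_Icc_self hy)).hasDerivWithinAt) x hx

theorem Amat_mul_shift {B : Matrix (Fin n) (Fin n) ℂ} {x : ℝ}
    (hB : IsUnit (B - (x : ℂ) • (1 : Matrix (Fin n) (Fin n) ℂ))) :
    Amat B x * (B - (x : ℂ) • (1 : Matrix (Fin n) (Fin n) ℂ)) = 1 :=
  Matrix.nonsing_inv_mul _ ((Matrix.isUnit_iff_isUnit_det _).1 hB)

theorem isUnit_Amat {B : Matrix (Fin n) (Fin n) ℂ} {x : ℝ}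
    (hB : IsUnit (B - (x : ℂ) • (1 : Matrix (Fin n) (Fin n) ℂ))) : IsUnit (Amat B x) :=
  IsUnit.of_mul_eq_one _ (Amat_mul_shift hB)

theorem isUnit_Amat_sub {B : Matrix (Fin n) (Fin n) ℂ} {x : ℝ} {z : ℂ}
    (hB : IsUnit (B - (x : ℂ) • (1 : Matrix (Fin n) (Fin n) ℂ))) (hz : z - (x : ℂ) ≠ 0)
    (hBz : IsUnit (B - z • (1 : Matrix (Fin n) (Fin n) ℂ))) :
    IsUnit (Amat B x - (z - (x : ℂ))⁻¹ • (1 : Matrix (Fin n) (Fin n) ℂ)) := by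
  have h : Amat B x - (z - (x : ℂ))⁻¹ • (1 : Matrix (Fin n) (Fin n) ℂ) =
      Amat B x * (-(z - (x : ℂ))⁻¹ • (B - z • (1 : Matrix (Fin n) (Fin n) ℂ))) := by
    have e : B - z • (1 : Matrix (Fin n) (Fin n) ℂ) =
        (B - (x : ℂ) • (1 : Matrix (Fin n) (Fin n) ℂ)) - (z - (x : ℂ)) • 1 := by
      module
    rw [e, Matrix.mul_smul, Matrix.mul_sub, Amat_mul_shift hB, Matrix.mul_smul, Matrix.mul_one,
      smul_sub, smul_smul, neg_mul, inv_mul_cancel₀ hz]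
    module
  rw [h]
  refine (isUnit_Amat hB).mul ?_
  have : IsUnit (algebraMap ℂ (Matrix (Fin n) (Fin n) ℂ) (-(z - (x : ℂ))⁻¹)) :=
    (isUnit_iff_ne_zero.2 (neg_ne_zero.2 (inv_ne_zero hz))).map _
  simpa [Algebra.smul_def] using this.mul hBz

/-- Hermitian symmetry of `S` propagates from the left end of the interval. -/
theorem isHermitian_of_hasDerivAt {a b : ℝ} {B : Matrix (Fin n) (Fin n) ℂ}
    {S K : ℝ → Matrix (Fin n) (Fin n) ℂ}
    (hB : ∀ x ∈ Set.Icc a b, IsUnit (B - (x : ℂ) • (1 : Matrix (Fin n) (Fin n) ℂ)))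
    (hK : ∀ x, (K x)ᴴ = K x)
    (hS : ∀ x ∈ Set.Icc a b,
      HasDerivAt S (K x - (Amat B x * S x + S x * (Amat B x)ᴴ)) x)
    (hSa : S a = (S a)ᴴ) : ∀ x ∈ Set.Icc a b, (S x)ᴴ = S x := by
  intro x hx
  have hconst := eq_of_hasDerivAt_matrix_zero
    (F := fun t => Amat B t * (S t - (S t)ᴴ) * (Amat B t)ᴴ) (a := a) (b := b) (by
      intro y hy
      have hA := hasDerivAt_Amat (hB y hy)
      refine ((hA.matrix_mul ((hS y hy).sub (hS y hy).matrix_conjTranspose)).matrix_mul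
        hA.matrix_conjTranspose).congr_deriv ?_
      simp only [Pi.sub_apply, Matrix.conjTranspose_sub, Matrix.conjTranspose_add,
        Matrix.conjTranspose_mul, hK, Matrix.conjTranspose_conjTranspose]
      noncomm_ring) x hx
  have h0 : Amat B x * (S x - (S x)ᴴ) * (Amat B x)ᴴ = 0 := by
    rw [hconst, ← hSa]
    simp
  have hu := isUnit_Amat (hB x hx)
  have hu' : IsUnit (Amat B x)ᴴ := hu.star
  have h1 := (IsUnit.mul_left_eq_zero hu').1 h0
  have h2 := (IsUnit.mul_right_eq_zero hu).1 h1
  exact (sub_eq_zero.1 h2).symm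

/-- The operator identity `A S − S A* = i Φ J Φ*` propagates from the left end of the interval. -/
theorem operator_identity_of_hasDerivAt {a b : ℝ} {J : Matrix (Fin m) (Fin m) ℂ}
    {B : Matrix (Fin n) (Fin n) ℂ} {H : ℝ → Matrix (Fin m) (Fin m) ℂ}
    {Φ : ℝ → Matrix (Fin n) (Fin m) ℂ} {S : ℝ → Matrix (Fin n) (Fin n) ℂ}
    (hJ : Jᴴ = J) (hH : ∀ x, (H x)ᴴ = H x)
    (hB : ∀ x ∈ Set.Icc a b, IsUnit (B - (x : ℂ) • (1 : Matrix (Fin n) (Fin n) ℂ)))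
    (hΦ : ∀ x ∈ Set.Icc a b,
      HasDerivAt Φ (-(Complex.I • (Amat B x * Φ x * J * H x))) x)
    (hS : ∀ x ∈ Set.Icc a b, HasDerivAt S
      (Φ x * J * H x * Jᴴ * (Φ x)ᴴ - (Amat B x * S x + S x * (Amat B x)ᴴ)) x)
    (hid : Amat B a * S a - S a * (Amat B a)ᴴ = Complex.I • (Φ a * J * (Φ a)ᴴ)) :
    ∀ x ∈ Set.Icc a b,
      Amat B x * S x - S x * (Amat B x)ᴴ = Complex.I • (Φ x * J * (Φ x)ᴴ) := by
  intro x hx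
  have hconst := eq_of_hasDerivAt_matrix_zero
    (F := fun t => Amat B t * S t - S t * (Amat B t)ᴴ - Complex.I • (Φ t * J * (Φ t)ᴴ))
    (a := a) (b := b) (by
      intro y hy
      have hA := hasDerivAt_Amat (hB y hy)
      have hF := hΦ y hy
      refine (((hA.matrix_mul (hS y hy)).sub
        ((hS y hy).matrix_mul hA.matrix_conjTranspose)).sub
        (((hF.matrix_mul (hasDerivAt_const y J)).matrix_mul
          hF.matrix_conjTranspose).const_smul Complex.I)).congr_deriv ?_
      simp only [Matrix.conjTranspose_neg, Matrix.conjTranspose_smul, Matrix.conjTranspose_mul,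
        hJ, hH, Matrix.mul_zero, add_zero, Matrix.mul_add, Matrix.add_mul, Matrix.mul_sub,
        Matrix.sub_mul, Matrix.mul_neg, Matrix.neg_mul, Matrix.mul_smul, Matrix.smul_mul,
        Matrix.mul_assoc, smul_add, smul_neg, smul_smul, Complex.I_mul_I, Complex.star_def,
        Complex.conj_I, mul_neg]
      module) x hx
  refine sub_eq_zero.1 ?_
  rw [hconst, hid, sub_self]

theorem isUnit_transferMat {J : Matrix (Fin m) (Fin m) ℂ}
    {A S : Matrix (Fin n) (Fin n) ℂ} {Φ : Matrix (Fin n) (Fin m) ℂ} {l : ℂ}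
    (hJ : Jᴴ = J) (hJJ : J * J = 1) (hS : Sᴴ = S) (hSu : IsUnit S)
    (hid : A * S - S * Aᴴ = Complex.I • (Φ * J * Φᴴ))
    (hA : IsUnit (A - l • (1 : Matrix (Fin n) (Fin n) ℂ)))
    (hA' : IsUnit (A - (starRingEnd ℂ l) • (1 : Matrix (Fin n) (Fin n) ℂ))) :
    IsUnit (transferMat J S Φ (A - l • (1 : Matrix (Fin n) (Fin n) ℂ))⁻¹) := by
  have h := congrArg (· * J) (transferMat_mul_mul_conjTranspose hJ hS hSu hid hA hA')
  simp only [hJJ, Matrix.mul_assoc] at h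
  exact IsUnit.of_mul_eq_one _ h

theorem w0fun_eq_transferMat (J : Matrix (Fin m) (Fin m) ℂ) (B : Matrix (Fin n) (Fin n) ℂ)
    (S : ℝ → Matrix (Fin n) (Fin n) ℂ) (Φ : ℝ → Matrix (Fin n) (Fin m) ℂ) (x : ℝ) :
    w0fun J B S Φ x =
      transferMat J (S x) (Φ x) (Amat B x - (0 : ℂ) • (1 : Matrix (Fin n) (Fin n) ℂ))⁻¹ := by
  rw [zero_smul, sub_zero]; rfl

section GBDT

variable {J H : Matrix (Fin m) (Fin m) ℂ} {B : Matrix (Fin n) (Fin n) ℂ}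
  {Φ : ℝ → Matrix (Fin n) (Fin m) ℂ} {S : ℝ → Matrix (Fin n) (Fin n) ℂ} {x : ℝ}

theorem w0fun_mul_mul_conjTranspose (hJ : Jᴴ = J)
    (hB : IsUnit (B - (x : ℂ) • (1 : Matrix (Fin n) (Fin n) ℂ)))
    (hid : Amat B x * S x - S x * (Amat B x)ᴴ = Complex.I • (Φ x * J * (Φ x)ᴴ))
    (hSh : (S x)ᴴ = S x) (hSu : IsUnit (S x)) :
    w0fun J B S Φ x * J * (w0fun J B S Φ x)ᴴ = J := by
  have hA : IsUnit (Amat B x - (0 : ℂ) • (1 : Matrix (Fin n) (Fin n) ℂ)) := by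
    simpa using isUnit_Amat hB
  have := transferMat_mul_mul_conjTranspose (l := 0) hJ hSh hSu hid hA (by simpa using hA)
  rw [map_zero] at this
  rwa [w0fun_eq_transferMat]

theorem isUnit_w0fun (hJ : Jᴴ = J) (hJJ : J * J = 1)
    (hB : IsUnit (B - (x : ℂ) • (1 : Matrix (Fin n) (Fin n) ℂ)))
    (hid : Amat B x * S x - S x * (Amat B x)ᴴ = Complex.I • (Φ x * J * (Φ x)ᴴ))
    (hSh : (S x)ᴴ = S x) (hSu : IsUnit (S x)) : IsUnit (w0fun J B S Φ x) := by
  have h := congrArg (· * J) (w0fun_mul_mul_conjTranspose hJ hB hid hSh hSu)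
  simp only [hJJ, Matrix.mul_assoc] at h
  exact IsUnit.of_mul_eq_one _ h

theorem hasDerivAt_w0fun (hJ : Jᴴ = J) (hH : Hᴴ = H)
    (hB : IsUnit (B - (x : ℂ) • (1 : Matrix (Fin n) (Fin n) ℂ)))
    (hΦ : HasDerivAt Φ (-(Complex.I • (Amat B x * Φ x * J * H))) x)
    (hS : HasDerivAt S
      (Φ x * J * H * Jᴴ * (Φ x)ᴴ - (Amat B x * S x + S x * (Amat B x)ᴴ)) x)
    (hid : Amat B x * S x - S x * (Amat B x)ᴴ = Complex.I • (Φ x * J * (Φ x)ᴴ))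
    (hSu : IsUnit (S x)) :
    HasDerivAt (w0fun J B S Φ)
      ((J * H * J * ((Φ x)ᴴ * (S x)⁻¹ * Φ x) - Complex.I • (J * ((Φ x)ᴴ * (S x)⁻¹ * Φ x)) -
        J * ((Φ x)ᴴ * (S x)⁻¹ * Φ x) * J * H) * w0fun J B S Φ x) x := by
  have h := hasDerivAt_transferMat (l := fun _ => 0) hJ hH hB hΦ hS hid hSu
    (by simpa using hasDerivAt_const x (0 : ℂ)) (by simpa using isUnit_Amat hB)
  rw [funext (w0fun_eq_transferMat J B S Φ)]
  exact h.congr_deriv (by simp only [mul_zero, zero_smul, add_zero])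

/-- The Darboux matrix intertwines the initial and the transformed canonical systems. -/
theorem hasDerivAt_vfun {z : ℂ} (hJ : Jᴴ = J) (hJJ : J * J = 1) (hH : Hᴴ = H)
    (hB : IsUnit (B - (x : ℂ) • (1 : Matrix (Fin n) (Fin n) ℂ)))
    (hΦ : HasDerivAt Φ (-(Complex.I • (Amat B x * Φ x * J * H))) x)
    (hS : HasDerivAt S
      (Φ x * J * H * Jᴴ * (Φ x)ᴴ - (Amat B x * S x + S x * (Amat B x)ᴴ)) x)
    (hid : Amat B x * S x - S x * (Amat B x)ᴴ = Complex.I • (Φ x * J * (Φ x)ᴴ))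
    (hSh : (S x)ᴴ = S x) (hSu : IsUnit (S x)) (hz : z ≠ (x : ℂ))
    (hBz : IsUnit (B - z • (1 : Matrix (Fin n) (Fin n) ℂ))) :
    HasDerivAt (vfun J B S Φ z)
      ((Complex.I * (z - (x : ℂ))⁻¹) •
        (J * ((w0fun J B S Φ x)ᴴ * H * w0fun J B S Φ x) * vfun J B S Φ z x -
          vfun J B S Φ z x * J * H)) x := by
  have hz' : z - (x : ℂ) ≠ 0 := sub_ne_zero.2 hz
  have hl : HasDerivAt (fun t : ℝ => (z - (t : ℂ))⁻¹)
      ((z - (x : ℂ))⁻¹ * (z - (x : ℂ))⁻¹) x := by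
    have h1 : HasDerivAt (fun t : ℝ => (t : ℂ)) 1 x := Complex.ofRealCLM.hasDerivAt
    refine ((h1.const_sub z).inv hz').congr_deriv ?_
    field_simp
  have hV := hasDerivAt_transferMat hJ hH hB hΦ hS hid hSu hl (isUnit_Amat_sub hB hz' hBz)
  have hw := hasDerivAt_w0fun hJ hH hB hΦ hS hid hSu
  have hwu := isUnit_w0fun hJ hJJ hB hid hSh hSu
  have hwJ := w0fun_mul_mul_conjTranspose hJ hB hid hSh hSu
  refine ((hw.matrix_inv hwu).matrix_mul hV).congr_deriv ?_
  have hwi : (w0fun J B S Φ x)⁻¹ * w0fun J B S Φ x = 1 :=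
    Matrix.nonsing_inv_mul _ ((Matrix.isUnit_iff_isUnit_det _).1 hwu)
  have hwi' : w0fun J B S Φ x * (w0fun J B S Φ x)⁻¹ = 1 :=
    Matrix.mul_nonsing_inv _ ((Matrix.isUnit_iff_isUnit_det _).1 hwu)
  have hJw : J * (w0fun J B S Φ x)ᴴ = (w0fun J B S Φ x)⁻¹ * J := by
    have := congrArg (fun M => (w0fun J B S Φ x)⁻¹ * M) hwJ
    simpa only [← Matrix.mul_assoc, hwi, Matrix.one_mul] using this
  have hv : vfun J B S Φ z x = (w0fun J B S Φ x)⁻¹ * transferMat J (S x) (Φ x)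
      (Amat B x - (z - (x : ℂ))⁻¹ • (1 : Matrix (Fin n) (Fin n) ℂ))⁻¹ := rfl
  rw [hv]
  generalize transferMat J (S x) (Φ x)
    (Amat B x - (z - (x : ℂ))⁻¹ • (1 : Matrix (Fin n) (Fin n) ℂ))⁻¹ = V
  generalize (J * H * J * ((Φ x)ᴴ * (S x)⁻¹ * Φ x) -
    Complex.I • (J * ((Φ x)ᴴ * (S x)⁻¹ * Φ x)) - J * ((Φ x)ᴴ * (S x)⁻¹ * Φ x) * J * H) = T
  generalize w0fun J B S Φ x = w at *
  have e1 : w⁻¹ * (T * w) * w⁻¹ * V = w⁻¹ * T * V := by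
    rw [← Matrix.mul_assoc, Matrix.mul_assoc (w⁻¹ * T), hwi', Matrix.mul_one]
  have e2 : J * (wᴴ * H * w) * (w⁻¹ * V) = w⁻¹ * (J * H * V) := by
    calc J * (wᴴ * H * w) * (w⁻¹ * V) = (J * wᴴ) * H * (w * w⁻¹) * V := by
          simp only [Matrix.mul_assoc]
      _ = _ := by rw [hJw, hwi']; simp only [Matrix.mul_assoc, Matrix.one_mul]
  rw [e2, Matrix.neg_mul, e1]
  simp only [Matrix.mul_add, Matrix.mul_sub, Matrix.mul_smul, Matrix.mul_assoc]
  abel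

theorem isUnit_vfun {z : ℂ} (hJ : Jᴴ = J) (hJJ : J * J = 1)
    (hB : IsUnit (B - (x : ℂ) • (1 : Matrix (Fin n) (Fin n) ℂ)))
    (hid : Amat B x * S x - S x * (Amat B x)ᴴ = Complex.I • (Φ x * J * (Φ x)ᴴ))
    (hSh : (S x)ᴴ = S x) (hSu : IsUnit (S x)) (hz : z ≠ (x : ℂ))
    (hBz : IsUnit (B - z • (1 : Matrix (Fin n) (Fin n) ℂ)))
    (hBz' : IsUnit (B - (starRingEnd ℂ z) • (1 : Matrix (Fin n) (Fin n) ℂ))) :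
    IsUnit (vfun J B S Φ z x) := by
  have hz' : z - (x : ℂ) ≠ 0 := sub_ne_zero.2 hz
  have hz'' : starRingEnd ℂ z - (x : ℂ) ≠ 0 := by
    have := (map_ne_zero (starRingEnd ℂ)).2 hz'
    simpa using this
  have hV := isUnit_transferMat hJ hJJ hSh hSu hid (isUnit_Amat_sub hB hz' hBz)
    (by simpa using isUnit_Amat_sub hB hz'' hBz')
  exact (Matrix.isUnit_nonsing_inv_iff.2 (isUnit_w0fun hJ hJJ hB hid hSh hSu)).mul hV

end GBDT

end Darboux

section TriangularModel

variable {m k : ℕ} {a b : ℝ} {J : Matrix (Fin m) (Fin m) ℂ} {β : ℝ → Matrix (Fin k) (Fin m) ℂ}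

/-- The space `L²_k(a,b)`. -/
noncomputable abbrev ModelSpace (k : ℕ) (a b : ℝ) :=
  Lp (EuclideanSpace ℂ (Fin k)) 2 (volume.restrict (Set.Ioo a b))

/-- `T` acts as `(T f)(x) = x f(x) + i ∫_a^x β(x) J β(t)* f(t) dt`. -/
def IsTriangularModel (J : Matrix (Fin m) (Fin m) ℂ) (β : ℝ → Matrix (Fin k) (Fin m) ℂ)
    (T : ModelSpace k a b →L[ℂ] ModelSpace k a b) : Prop :=
  ∀ f : ModelSpace k a b, ∀ᵐ x ∂(volume.restrict (Set.Ioo a b)),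
    (T f) x = (x : ℂ) • f x + Complex.I •
      ∫ t in a..x, (WithLp.equiv 2 (Fin k → ℂ)).symm
        ((β x * J * (β t)ᴴ).mulVec (WithLp.equiv 2 (Fin k → ℂ) (f t)))

/-- `𝒦` acts as `(𝒦 g)(x) = β(x) g`. -/
def IsChannel (β : ℝ → Matrix (Fin k) (Fin m) ℂ)
    (𝒦 : EuclideanSpace ℂ (Fin m) →L[ℂ] ModelSpace k a b) : Prop :=
  ∀ g : EuclideanSpace ℂ (Fin m), ∀ᵐ x ∂(volume.restrict (Set.Ioo a b)),
    (𝒦 g) x = (WithLp.equiv 2 (Fin k → ℂ)).symm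
      ((β x).mulVec (WithLp.equiv 2 (Fin m → ℂ) g))

/-- The primitive `x ↦ ∫_a^x β(t)* f(t) dt`. -/
noncomputable def channelIntegral (a : ℝ) (β : ℝ → Matrix (Fin k) (Fin m) ℂ)
    (f : ℝ → EuclideanSpace ℂ (Fin k)) (x : ℝ) : Fin m → ℂ :=
  fun j => ∫ t in a..x, ((β t)ᴴ *ᵥ (f t).ofLp) j

theorem continuousOn_matrix_apply {ι κ : Type*} [Fintype ι] [Fintype κ]
    {F : ℝ → Matrix ι κ ℂ} {s : Set ℝ} (hF : ContinuousOn F s) (i : ι) (j : κ) :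
    ContinuousOn (fun t => F t i j) s :=
  continuousOn_pi.1 (continuousOn_pi.1 hF i) j

theorem continuousOn_matrix_mulVec {ι κ : Type*} [Fintype ι] [Fintype κ]
    {F : ℝ → Matrix ι κ ℂ} {u : ℝ → κ → ℂ} {s : Set ℝ} (hF : ContinuousOn F s)
    (hu : ContinuousOn u s) : ContinuousOn (fun t => F t *ᵥ u t) s :=
  continuousOn_pi.2 fun i => continuousOn_finsetSum _ fun j _ =>
    (continuousOn_matrix_apply hF i j).mul (continuousOn_pi.1 hu j)

theorem continuousOn_matrix_conjTranspose {ι κ : Type*} [Fintype ι] [Fintype κ]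
    {F : ℝ → Matrix ι κ ℂ} {s : Set ℝ} (hF : ContinuousOn F s) :
    ContinuousOn (fun t => (F t)ᴴ) s :=
  continuousOn_pi.2 fun i => continuousOn_pi.2 fun j => (continuousOn_matrix_apply hF j i).star

theorem integrableOn_channel (hβ : ContinuousOn β (Set.Icc a b)) (f : ModelSpace k a b)
    (j : Fin m) : IntegrableOn (fun t => ((β t)ᴴ *ᵥ (f t).ofLp) j) (Set.Icc a b) := by
  have hf : Integrable (fun t => f t) (volume.restrict (Set.Ioo a b)) :=
    (Lp.memLp f).integrable one_le_two
  simp only [Matrix.mulVec, dotProduct]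
  refine integrable_finsetSum _ fun i _ => ?_
  have hfi : IntegrableOn (fun t => (f t).ofLp i) (Set.Icc a b) := by
    rw [integrableOn_Icc_iff_integrableOn_Ioo]
    exact hf.eval_piLp i
  exact hfi.continuousOn_mul
    (continuousOn_matrix_apply (continuousOn_matrix_conjTranspose hβ) j i) isCompact_Icc

theorem intervalIntegrable_channel (hβ : ContinuousOn β (Set.Icc a b)) (f : ModelSpace k a b)
    (j : Fin m) {x : ℝ} (hx : x ∈ Set.Icc a b) :
    IntervalIntegrable (fun t => ((β t)ᴴ *ᵥ (f t).ofLp) j) volume a x :=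
  (intervalIntegrable_iff_integrableOn_Icc_of_le hx.1).2
    ((integrableOn_channel hβ f j).mono_set (Set.Icc_subset_Icc_right hx.2))

theorem continuousOn_channelIntegral (hab : a ≤ b) (hβ : ContinuousOn β (Set.Icc a b))
    (f : ModelSpace k a b) : ContinuousOn (channelIntegral a β f) (Set.Icc a b) := by
  refine continuousOn_pi.2 fun j => ?_
  have := intervalIntegral.continuousOn_primitive_interval (μ := volume)
    (f := fun t => ((β t)ᴴ *ᵥ (f t).ofLp) j) (a := a) (b := b)
    (by rw [Set.uIcc_of_le hab]; exact integrableOn_channel hβ f j)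
  rwa [Set.uIcc_of_le hab] at this

theorem channelIntegral_congr {f g : ℝ → EuclideanSpace ℂ (Fin k)}
    (h : ∀ᵐ t ∂(volume.restrict (Set.Ioo a b)), f t = g t) {x : ℝ} (hx : x ∈ Set.Icc a b) :
    channelIntegral a β f x = channelIntegral a β g x := by
  ext j
  refine intervalIntegral.integral_congr_ae_restrict ?_
  rw [Set.uIoc_of_le hx.1, ← restrict_Ioo_eq_restrict_Ioc]
  filter_upwards [ae_restrict_of_ae_restrict_of_subset
    (Set.Ioo_subset_Ioo_right hx.2) h] with t ht
  rw [ht]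

theorem triangular_integral_apply (hβ : ContinuousOn β (Set.Icc a b)) (f : ModelSpace k a b)
    (M : Matrix (Fin k) (Fin m) ℂ) {x : ℝ} (hx : x ∈ Set.Icc a b) :
    (∫ t in a..x, (WithLp.equiv 2 (Fin k → ℂ)).symm
        ((M * J * (β t)ᴴ).mulVec (WithLp.equiv 2 (Fin k → ℂ) (f t)))).ofLp =
      M *ᵥ (J *ᵥ channelIntegral a β f x) := by
  ext i
  have hexp : ∀ t i, ((M * J * (β t)ᴴ) *ᵥ (f t).ofLp) i =
      ∑ j, (M * J) i j * ((β t)ᴴ *ᵥ (f t).ofLp) j := by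
    intro t i
    rw [← Matrix.mulVec_mulVec]; rfl
  have hint : ∀ j, Integrable (fun t => ((β t)ᴴ *ᵥ (f t).ofLp) j)
      (volume.restrict (Set.Ioc a x)) := fun j =>
    (intervalIntegrable_iff_integrableOn_Ioc_of_le hx.1).1 (intervalIntegrable_channel hβ f j hx)
  rw [intervalIntegral.integral_of_le hx.1, eval_integral_piLp]
  · simp only [WithLp.equiv_symm_apply, WithLp.equiv_apply, hexp]
    rw [integral_finsetSum _ fun j _ => (hint j).const_mul _, Matrix.mulVec_mulVec]
    simp only [integral_const_mul, Matrix.mulVec, dotProduct, channelIntegral,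
      intervalIntegral.integral_of_le hx.1]
  · intro i
    simp only [WithLp.equiv_symm_apply, WithLp.equiv_apply, hexp]
    exact integrable_finsetSum _ fun j _ => (hint j).const_mul _

theorem IsTriangularModel.ae_eq {T : ModelSpace k a b →L[ℂ] ModelSpace k a b}
    (hT : IsTriangularModel J β T) (hβ : ContinuousOn β (Set.Icc a b)) (f : ModelSpace k a b) :
    ∀ᵐ x ∂(volume.restrict (Set.Ioo a b)), ((T f) x).ofLp =
      (x : ℂ) • (f x).ofLp + Complex.I • (β x *ᵥ (J *ᵥ channelIntegral a β f x)) := by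
  filter_upwards [hT f, ae_restrict_mem measurableSet_Ioo] with x hx hxm
  rw [hx, WithLp.ofLp_add, WithLp.ofLp_smul, WithLp.ofLp_smul,
    triangular_integral_apply hβ f _ (Set.Ioo_subset_Icc_self hxm)]

theorem IsChannel.adjoint_apply {𝒦 : EuclideanSpace ℂ (Fin m) →L[ℂ] ModelSpace k a b}
    (h𝒦 : IsChannel β 𝒦) (hab : a ≤ b) (f : ModelSpace k a b) (p : Fin m) :
    (ContinuousLinearMap.adjoint 𝒦 f) p = channelIntegral a β f b p := by
  have h1 : (ContinuousLinearMap.adjoint 𝒦 f) p =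
      inner ℂ (EuclideanSpace.single p (1 : ℂ)) (ContinuousLinearMap.adjoint 𝒦 f) := by
    simp [EuclideanSpace.inner_single_left]
  rw [h1, ContinuousLinearMap.adjoint_inner_right, L2.inner_def, channelIntegral,
    intervalIntegral.integral_of_le hab, ← restrict_Ioo_eq_restrict_Ioc]
  refine integral_congr_ae ?_
  filter_upwards [h𝒦 (EuclideanSpace.single p (1 : ℂ))] with t ht
  rw [ht]
  simp [PiLp.inner_apply, Matrix.mulVec, dotProduct, mul_comm]

theorem charFun_mulVec {𝒦 : EuclideanSpace ℂ (Fin m) →L[ℂ] ModelSpace k a b}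
    (h𝒦 : IsChannel β 𝒦) (hab : a ≤ b) (R : ModelSpace k a b →L[ℂ] ModelSpace k a b)
    (g : Fin m → ℂ) :
    charFun a b J 𝒦 R *ᵥ g =
      g - Complex.I • (J *ᵥ channelIntegral a β (R (𝒦 (WithLp.toLp 2 g))) b) := by
  have h : (Matrix.of fun p q : Fin m =>
      (ContinuousLinearMap.adjoint 𝒦 (R (𝒦 (EuclideanSpace.single q 1)))) p) *ᵥ g =
      channelIntegral a β (R (𝒦 (WithLp.toLp 2 g))) b := by
    ext p
    rw [← h𝒦.adjoint_apply hab]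
    have hg : WithLp.toLp 2 g = ∑ q, g q • EuclideanSpace.single q (1 : ℂ) := by
      ext i
      simp [Pi.single_apply]
    rw [hg]
    simp [Matrix.mulVec, dotProduct, map_sum, mul_comm]
  rw [_root_.charFun, Matrix.sub_mulVec, Matrix.one_mulVec, Matrix.smul_mulVec, ← Matrix.mulVec_mulVec,
    h]

theorem continuousOn_inv_sub {z : ℂ} {s : Set ℝ} (hz : ∀ x ∈ s, z ≠ (x : ℂ)) :
    ContinuousOn (fun t : ℝ => (z - (t : ℂ))⁻¹) s :=
  ContinuousOn.inv₀ (by fun_prop) fun x hx => sub_ne_zero.2 (hz x hx)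

/-- The characteristic function is the value at `b` of solutions of the canonical system. -/
theorem exists_solution_charFun {T R : ModelSpace k a b →L[ℂ] ModelSpace k a b}
    {𝒦 : EuclideanSpace ℂ (Fin m) →L[ℂ] ModelSpace k a b} {z : ℂ}
    (hT : IsTriangularModel J β T) (h𝒦 : IsChannel β 𝒦) (hab : a ≤ b)
    (hβ : ContinuousOn β (Set.Icc a b)) (hz : ∀ x ∈ Set.Icc a b, z ≠ (x : ℂ))
    (hR : (T - z • ContinuousLinearMap.id ℂ _).comp R = ContinuousLinearMap.id ℂ _)
    (g : Fin m → ℂ) :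
    ∃ u : ℝ → Fin m → ℂ, ContinuousOn u (Set.Icc a b) ∧ u a = g ∧
      (∀ x ∈ Set.Ioo a b, HasDerivAt u
        ((Complex.I * (z - (x : ℂ))⁻¹) • ((J * ((β x)ᴴ * β x)) *ᵥ u x)) x) ∧
      u b = charFun a b J 𝒦 R *ᵥ g := by
  set f : ModelSpace k a b := R (𝒦 (WithLp.toLp 2 g)) with hf
  have hTf : T f - z • f = 𝒦 (WithLp.toLp 2 g) := by
    have := DFunLike.congr_fun hR (𝒦 (WithLp.toLp 2 g))
    simpa using this
  set u : ℝ → Fin m → ℂ := fun x => g - Complex.I • (J *ᵥ channelIntegral a β f x) with hu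
  have hc := continuousOn_channelIntegral hab hβ f
  have huc : ContinuousOn u (Set.Icc a b) :=
    continuousOn_const.sub
      ((continuousOn_matrix_mulVec continuousOn_const hc).fun_const_smul Complex.I)
  have hfu : ∀ᵐ x ∂(volume.restrict (Set.Ioo a b)),
      f x = WithLp.toLp 2 (-(z - (x : ℂ))⁻¹ • (β x *ᵥ u x)) := by
    filter_upwards [hT.ae_eq hβ f, h𝒦 (WithLp.toLp 2 g), Lp.coeFn_sub (T f) (z • f),
      Lp.coeFn_smul z f, ae_restrict_mem measurableSet_Ioo] with x h1 h2 h3 h4 hxm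
    have hzx : z - (x : ℂ) ≠ 0 := sub_ne_zero.2 (hz x (Set.Ioo_subset_Icc_self hxm))
    rw [hTf] at h3
    rw [h3, Pi.sub_apply, h4, Pi.smul_apply] at h2
    have h5 := congrArg WithLp.ofLp h2
    simp only [WithLp.ofLp_sub, WithLp.ofLp_smul, WithLp.equiv_symm_apply, WithLp.equiv_apply,
      h1] at h5
    have h6 : β x *ᵥ u x = -(z - (x : ℂ)) • (f x).ofLp := by
      simp only [hu, Matrix.mulVec_sub, Matrix.mulVec_smul]
      rw [← h5]
      module
    rw [h6, smul_smul, neg_mul_neg, inv_mul_cancel₀ hzx, one_smul]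
  have hint : ContinuousOn
      (fun t : ℝ => (β t)ᴴ *ᵥ (-(z - (t : ℂ))⁻¹ • (β t *ᵥ u t))) (Set.Icc a b) :=
    continuousOn_matrix_mulVec (continuousOn_matrix_conjTranspose hβ)
      ((continuousOn_inv_sub hz).neg.smul (continuousOn_matrix_mulVec hβ huc))
  refine ⟨u, huc, ?_, ?_, ?_⟩
  · have : channelIntegral a β f a = 0 := by
      ext j; simp [channelIntegral]
    simp [hu, this]
  · intro x hx
    have hcd : HasDerivAt (channelIntegral a β f)
        ((β x)ᴴ *ᵥ (-(z - (x : ℂ))⁻¹ • (β x *ᵥ u x))) x := by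
      rw [hasDerivAt_pi]
      intro j
      have hj := continuousOn_pi.1 hint j
      have hnhds : Set.Icc a b ∈ nhds x := Icc_mem_nhds hx.1 hx.2
      have hd := intervalIntegral.integral_hasDerivAt_right (a := a) (b := x)
        ((hj.mono (Set.Icc_subset_Icc_right hx.2.le)).intervalIntegrable_of_Icc hx.1.le)
        (hj.stronglyMeasurableAtFilter_nhdsWithin measurableSet_Icc x |>.filter_mono
          (by rw [nhdsWithin_eq_nhds.2 hnhds]))
        (hj.continuousAt hnhds)
      refine hd.congr_of_eventuallyEq ?_
      filter_upwards [hnhds] with y hy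
      rw [channelIntegral_congr hfu hy]
      rfl
    have hd := (((hasDerivAt_const x J).matrix_mulVec hcd).const_smul Complex.I).const_sub g
    refine hd.congr_deriv ?_
    simp only [Matrix.zero_mulVec, zero_add, Matrix.mulVec_smul, ← Matrix.mulVec_mulVec]
    module
  · rw [charFun_mulVec h𝒦 hab]

/-- The characteristic function maps initial to terminal values of solutions of the canonical
system. -/
theorem charFun_mulVec_of_solution {T R : ModelSpace k a b →L[ℂ] ModelSpace k a b}
    {𝒦 : EuclideanSpace ℂ (Fin m) →L[ℂ] ModelSpace k a b} {z : ℂ}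
    (hT : IsTriangularModel J β T) (h𝒦 : IsChannel β 𝒦) (hab : a ≤ b)
    (hβ : ContinuousOn β (Set.Icc a b)) (hz : ∀ x ∈ Set.Icc a b, z ≠ (x : ℂ))
    (hR : R.comp (T - z • ContinuousLinearMap.id ℂ _) = ContinuousLinearMap.id ℂ _)
    {u : ℝ → Fin m → ℂ} (huc : ContinuousOn u (Set.Icc a b))
    (hu : ∀ x ∈ Set.Ioo a b, HasDerivAt u
      ((Complex.I * (z - (x : ℂ))⁻¹) • ((J * ((β x)ᴴ * β x)) *ᵥ u x)) x) :
    charFun a b J 𝒦 R *ᵥ u a = u b := by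
  set f₀ : ℝ → EuclideanSpace ℂ (Fin k) :=
    fun x => WithLp.toLp 2 (-(z - (x : ℂ))⁻¹ • (β x *ᵥ u x)) with hf₀
  have hf₀c : ContinuousOn f₀ (Set.Icc a b) :=
    (PiLp.continuous_toLp 2 _).comp_continuousOn
      ((continuousOn_inv_sub hz).neg.smul (continuousOn_matrix_mulVec hβ huc))
  have hmem : MemLp f₀ 2 (volume.restrict (Set.Ioo a b)) := by
    obtain ⟨C, hC⟩ := isCompact_Icc.exists_bound_of_continuousOn hf₀c
    exact MemLp.of_bound
      ((hf₀c.mono Set.Ioo_subset_Icc_self).aestronglyMeasurable measurableSet_Ioo) C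
      (ae_restrict_of_forall_mem measurableSet_Ioo fun x hx => hC x (Set.Ioo_subset_Icc_self hx))
  set f : ModelSpace k a b := hmem.toLp f₀
  have hff₀ : ∀ᵐ x ∂(volume.restrict (Set.Ioo a b)), f x = f₀ x := hmem.coeFn_toLp
  have hint : ContinuousOn (fun t : ℝ => (β t)ᴴ *ᵥ (f₀ t).ofLp) (Set.Icc a b) :=
    continuousOn_matrix_mulVec (continuousOn_matrix_conjTranspose hβ)
      ((PiLp.continuous_ofLp 2 _).comp_continuousOn hf₀c)
  have hprim : ∀ x ∈ Set.Icc a b,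
      Complex.I • (J *ᵥ channelIntegral a β f x) = u a - u x := by
    intro x hx
    rw [channelIntegral_congr hff₀ hx]
    ext i
    have hsub : Set.Icc a x ⊆ Set.Icc a b := Set.Icc_subset_Icc_right hx.2
    have hij : ∀ j, IntervalIntegrable (fun t => ((β t)ᴴ *ᵥ (f₀ t).ofLp) j) volume a x :=
      fun j => ((continuousOn_pi.1 hint j).mono hsub).intervalIntegrable_of_Icc hx.1
    have hsum : IntervalIntegrable
        (fun t => -(Complex.I * ∑ j, J i j * ((β t)ᴴ *ᵥ (f₀ t).ofLp) j)) volume a x :=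
      (ContinuousOn.intervalIntegrable_of_Icc hx.1 <| ContinuousOn.neg <|
        continuousOn_const.mul <| continuousOn_finsetSum _ fun j _ =>
          continuousOn_const.mul ((continuousOn_pi.1 hint j).mono hsub))
    have hftc := intervalIntegral.integral_eq_sub_of_hasDerivAt_of_le (f := fun t => u t i)
      (f' := fun t => -(Complex.I * ∑ j, J i j * ((β t)ᴴ *ᵥ (f₀ t).ofLp) j)) hx.1
      ((continuousOn_pi.1 huc i).mono hsub) (by
        intro t ht
        refine (hasDerivAt_pi.1 (hu t ⟨ht.1, ht.2.trans_le hx.2⟩) i).congr_deriv ?_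
        have : ∑ j, J i j * ((β t)ᴴ *ᵥ (f₀ t).ofLp) j = (J *ᵥ ((β t)ᴴ *ᵥ (f₀ t).ofLp)) i := rfl
        rw [this]
        simp only [hf₀, Matrix.mulVec_smul, ← Matrix.mulVec_mulVec, Pi.smul_apply, smul_eq_mul]
        ring)
      hsum
    rw [intervalIntegral.integral_neg, intervalIntegral.integral_const_mul,
      intervalIntegral.integral_finsetSum fun j _ => (hij j).const_mul _] at hftc
    simp only [intervalIntegral.integral_const_mul] at hftc
    simp only [Pi.smul_apply, Pi.sub_apply, smul_eq_mul, Matrix.mulVec, dotProduct,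
      channelIntegral] at hftc ⊢
    rw [← neg_sub, ← hftc, neg_neg]
  have hTf : T f - z • f = 𝒦 (WithLp.toLp 2 (u a)) := by
    refine Lp.ext ?_
    filter_upwards [hT.ae_eq hβ f, h𝒦 (WithLp.toLp 2 (u a)), Lp.coeFn_sub (T f) (z • f),
      Lp.coeFn_smul z f, hff₀, ae_restrict_mem measurableSet_Ioo] with x h1 h2 h3 h4 h5 hxm
    have hxm' := Set.Ioo_subset_Icc_self hxm
    have hzx : z - (x : ℂ) ≠ 0 := sub_ne_zero.2 (hz x hxm')
    rw [h2, h3, Pi.sub_apply, h4, Pi.smul_apply]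
    refine WithLp.ofLp_injective 2 ?_
    rw [← Matrix.mulVec_smul, hprim x hxm', h5] at h1
    simp only [WithLp.ofLp_sub, WithLp.ofLp_smul, WithLp.equiv_symm_apply, WithLp.equiv_apply, h1,
      h5, hf₀, Matrix.mulVec_sub, smul_smul]
    have e : β x *ᵥ u x = ((z - (x : ℂ)) * (z - (x : ℂ))⁻¹) • (β x *ᵥ u x) := by
      rw [mul_inv_cancel₀ hzx, one_smul]
    conv_lhs => enter [1, 2, 2]; rw [e]
    module
  have hRf : R (𝒦 (WithLp.toLp 2 (u a))) = f := by
    have := DFunLike.congr_fun hR f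
    rw [← hTf]
    simpa using this
  rw [charFun_mulVec h𝒦 hab, hRf, hprim b (Set.right_mem_Icc.2 hab)]
  abel

end TriangularModel

/-- Proposition 4.1: the characteristic functions of the initial
and GBDT-transformed triangular model operators on `L²_k(a,b)` are connected by
`𝒲̃(z) = v(b,z) 𝒲(z) v(a,z)⁻¹`. -/
theorem stmt_17 {m k n : ℕ} (a b : ℝ) (hab : a ≤ b)
    (J : Matrix (Fin m) (Fin m) ℂ) (hJherm : Jᴴ = J) (hJinv : J * J = 1)
    (β : ℝ → Matrix (Fin k) (Fin m) ℂ) (hβcont : ContinuousOn β (Set.Icc a b))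
    (B : Matrix (Fin n) (Fin n) ℂ)
    (hB : ∀ x ∈ Set.Icc a b,
      IsUnit (B - (x : ℂ) • (1 : Matrix (Fin n) (Fin n) ℂ)))
    (Φ : ℝ → Matrix (Fin n) (Fin m) ℂ) (S : ℝ → Matrix (Fin n) (Fin n) ℂ)
    (hΦ : ∀ x ∈ Set.Icc a b,
      HasDerivAt Φ (-(Complex.I • (Amat B x * Φ x * J * ((β x)ᴴ * β x)))) x)
    (hS : ∀ x ∈ Set.Icc a b, HasDerivAt S
      (Φ x * J * ((β x)ᴴ * β x) * Jᴴ * (Φ x)ᴴ -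
        (Amat B x * S x + S x * (Amat B x)ᴴ)) x)
    (hSa : S a = (S a)ᴴ)
    (hid : Amat B a * S a - S a * (Amat B a)ᴴ = Complex.I • (Φ a * J * (Φ a)ᴴ))
    (hSinv : ∀ x ∈ Set.Icc a b, IsUnit (S x))
    (𝔄 𝔄t : Lp (EuclideanSpace ℂ (Fin k)) 2 (volume.restrict (Set.Ioo a b)) →L[ℂ]
      Lp (EuclideanSpace ℂ (Fin k)) 2 (volume.restrict (Set.Ioo a b)))
    (h𝔄 : ∀ f : Lp (EuclideanSpace ℂ (Fin k)) 2 (volume.restrict (Set.Ioo a b)),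
      ∀ᵐ x ∂(volume.restrict (Set.Ioo a b)),
        (𝔄 f) x = (x : ℂ) • f x + Complex.I •
          ∫ t in a..x, (WithLp.equiv 2 (Fin k → ℂ)).symm
            ((β x * J * (β t)ᴴ).mulVec (WithLp.equiv 2 (Fin k → ℂ) (f t))))
    (h𝔄t : ∀ f : Lp (EuclideanSpace ℂ (Fin k)) 2 (volume.restrict (Set.Ioo a b)),
      ∀ᵐ x ∂(volume.restrict (Set.Ioo a b)),
        (𝔄t f) x = (x : ℂ) • f x + Complex.I •
          ∫ t in a..x, (WithLp.equiv 2 (Fin k → ℂ)).symm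
            (((β x * w0fun J B S Φ x) * J * (β t * w0fun J B S Φ t)ᴴ).mulVec
              (WithLp.equiv 2 (Fin k → ℂ) (f t))))
    (𝒦 𝒦t : EuclideanSpace ℂ (Fin m) →L[ℂ]
      Lp (EuclideanSpace ℂ (Fin k)) 2 (volume.restrict (Set.Ioo a b)))
    (h𝒦 : ∀ g : EuclideanSpace ℂ (Fin m),
      ∀ᵐ x ∂(volume.restrict (Set.Ioo a b)),
        (𝒦 g) x = (WithLp.equiv 2 (Fin k → ℂ)).symm
          ((β x).mulVec (WithLp.equiv 2 (Fin m → ℂ) g)))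
    (h𝒦t : ∀ g : EuclideanSpace ℂ (Fin m),
      ∀ᵐ x ∂(volume.restrict (Set.Ioo a b)),
        (𝒦t g) x = (WithLp.equiv 2 (Fin k → ℂ)).symm
          ((β x * w0fun J B S Φ x).mulVec (WithLp.equiv 2 (Fin m → ℂ) g)))
    (R Rt : ℂ → (Lp (EuclideanSpace ℂ (Fin k)) 2 (volume.restrict (Set.Ioo a b)) →L[ℂ]
      Lp (EuclideanSpace ℂ (Fin k)) 2 (volume.restrict (Set.Ioo a b))))
    (hR : ∀ z : ℂ, (∀ x ∈ Set.Icc a b, z ≠ (x : ℂ)) →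
      (𝔄 - z • ContinuousLinearMap.id ℂ _).comp (R z) = ContinuousLinearMap.id ℂ _ ∧
      (R z).comp (𝔄 - z • ContinuousLinearMap.id ℂ _) = ContinuousLinearMap.id ℂ _)
    (hRt : ∀ z : ℂ, (∀ x ∈ Set.Icc a b, z ≠ (x : ℂ)) →
      (𝔄t - z • ContinuousLinearMap.id ℂ _).comp (Rt z) = ContinuousLinearMap.id ℂ _ ∧
      (Rt z).comp (𝔄t - z • ContinuousLinearMap.id ℂ _) = ContinuousLinearMap.id ℂ _) :
    ∀ z : ℂ, (∀ x ∈ Set.Icc a b, z ≠ (x : ℂ)) →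
      IsUnit (B - z • (1 : Matrix (Fin n) (Fin n) ℂ)) →
      IsUnit (B - (starRingEnd ℂ z) • (1 : Matrix (Fin n) (Fin n) ℂ)) →
      charFun a b J 𝒦t (Rt z) =
        vfun J B S Φ z b * charFun a b J 𝒦 (R z) * (vfun J B S Φ z a)⁻¹ := by
  intro z hz hBz hBz'
  have haI : a ∈ Set.Icc a b := Set.left_mem_Icc.2 hab
  have hH : ∀ x, ((β x)ᴴ * β x)ᴴ = (β x)ᴴ * β x := fun x => by simp
  have hSh : ∀ x ∈ Set.Icc a b, (S x)ᴴ = S x :=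
    isHermitian_of_hasDerivAt (K := fun x => Φ x * J * ((β x)ᴴ * β x) * Jᴴ * (Φ x)ᴴ) hB
      (fun x => by simp [Matrix.conjTranspose_mul, hJherm, Matrix.mul_assoc]) hS hSa
  have hidx := operator_identity_of_hasDerivAt (H := fun x => (β x)ᴴ * β x)
    hJherm hH hB hΦ hS hid
  have hv : ∀ x ∈ Set.Icc a b, HasDerivAt (vfun J B S Φ z) _ x := fun x hx =>
    hasDerivAt_vfun hJherm hJinv (hH x) (hB x hx) (hΦ x hx) (hS x hx) (hidx x hx) (hSh x hx)
      (hSinv x hx) (hz x hx) hBz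
  have hvc : ContinuousOn (vfun J B S Φ z) (Set.Icc a b) := fun x hx =>
    (hv x hx).continuousAt.continuousWithinAt
  have hwc : ContinuousOn (w0fun J B S Φ) (Set.Icc a b) := fun x hx =>
    (hasDerivAt_w0fun hJherm (hH x) (hB x hx) (hΦ x hx) (hS x hx) (hidx x hx)
      (hSinv x hx)).continuousAt.continuousWithinAt
  have hβt : ContinuousOn (fun x => β x * w0fun J B S Φ x) (Set.Icc a b) :=
    continuousOn_pi.2 fun i => continuousOn_pi.2 fun j => by
      simp only [Matrix.mul_apply]
      exact continuousOn_finsetSum _ fun l _ =>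
        (continuousOn_matrix_apply hβcont i l).mul (continuousOn_matrix_apply hwc l j)
  have hmul : charFun a b J 𝒦t (Rt z) * vfun J B S Φ z a =
      vfun J B S Φ z b * charFun a b J 𝒦 (R z) := by
    refine Matrix.ext_of_mulVec_single fun q => ?_
    obtain ⟨u, huc, hua, hud, hub⟩ := exists_solution_charFun (J := J) (β := β) h𝔄 h𝒦 hab hβcont
      hz (hR z hz).1 (Pi.single q 1)
    rw [← Matrix.mulVec_mulVec, ← Matrix.mulVec_mulVec, ← hub, ← hua]
    refine charFun_mulVec_of_solution (J := J) (β := fun x => β x * w0fun J B S Φ x)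
      (u := fun x => vfun J B S Φ z x *ᵥ u x) h𝔄t h𝒦t hab hβt hz (hRt z hz).2
      (continuousOn_matrix_mulVec hvc huc) fun x hx => ?_
    refine ((hv x (Set.Ioo_subset_Icc_self hx)).matrix_mulVec (hud x hx)).congr_deriv ?_
    simp only [Matrix.mulVec_smul, Matrix.smul_mulVec, Matrix.sub_mulVec,
      Matrix.mulVec_mulVec, Matrix.conjTranspose_mul, Matrix.mul_assoc]
    module
  have hva : IsUnit (vfun J B S Φ z a) :=
    isUnit_vfun hJherm hJinv (hB a haI) (hidx a haI) (hSh a haI) (hSinv a haI) (hz a haI) hBz hBz'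
  rw [← hmul, Matrix.mul_assoc,
    Matrix.mul_nonsing_inv _ ((Matrix.isUnit_iff_isUnit_det _).1 hva), Matrix.mul_one]
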